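/- (Proposition 6, Even Pilot Selection) Let n ≥ 2, N = 2^n, let A ⊆ {0, ..., N−1} be domination-upward-closed, let D = { i ∈ {0, ..., N−1} : i ≡ 3 (mod 4) }, and let D_f = Ā ∩ D. Then for C = A ∪ D_f, the submatrix G_C̄C of G_N = F^{⊗n} is the zero matrix. -/

import Mathlib

open Matrix

/-- The polar kernel `F = [[1,0],[1,1]]` over `GF(2)`. -/
def polarF : Matrix (Fin 2) (Fin 2) (ZMod 2) := !![1, 0; 1, 1]

/-- The `n`-fold Kronecker power `G_N = F^{⊗ n}` over `GF(2)`,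
indexed by `Fin (2 ^ n)` via the standard mixed-radix (binary) identification. -/
def polarG : (n : ℕ) → Matrix (Fin (2 ^ n)) (Fin (2 ^ n)) (ZMod 2)
  | 0 => 1
  | n + 1 =>
      Matrix.reindex
        (finProdFinEquiv.trans (finCongr (by rw [pow_succ, Nat.mul_comm])))
        (finProdFinEquiv.trans (finCongr (by rw [pow_succ, Nat.mul_comm])))
        (Matrix.kronecker polarF (polarG n))

/-- Binary domination `i ⪰ j` : every bit equal to 1 in `j` is also 1 in `i`. -/
def Dominates (i j : ℕ) : Prop := ∀ t : ℕ, j.testBit t = true → i.testBit t = true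

/-- `A` is domination-upward-closed. -/
def UpClosed {n : ℕ} (A : Finset (Fin (2 ^ n))) : Prop :=
  ∀ i ∈ A, ∀ j : Fin (2 ^ n), Dominates (j : ℕ) (i : ℕ) → j ∈ A

/-- The square submatrix `G_CC` of `G_N`, rows and columns indexed by the
elements of `C` listed in increasing order. -/
def subCC {n : ℕ} (C : Finset (Fin (2 ^ n))) :
    Matrix (Fin C.card) (Fin C.card) (ZMod 2) :=
  (polarG n).submatrix (⇑(C.orderEmbOfFin rfl)) (⇑(C.orderEmbOfFin rfl))

theorem dominates_of_polarF_ne_zero {a b : Fin 2} (h : polarF a b ≠ 0) :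
    Dominates (a : ℕ) (b : ℕ) := by
  fin_cases a <;> fin_cases b <;> simp_all [polarF, Dominates]

theorem Dominates.two_pow_mul_add {n a b c d : ℕ} (hb : b < 2 ^ n) (hd : d < 2 ^ n)
    (hac : Dominates a c) (hbd : Dominates b d) :
    Dominates (2 ^ n * a + b) (2 ^ n * c + d) := by
  intro t
  rw [Nat.testBit_two_pow_mul_add _ hb, Nat.testBit_two_pow_mul_add _ hd]
  split_ifs
  · exact hbd t
  · exact hac (t - n)

/-- The nonzero entries of `G_N` occur only at positions `(i, j)` with `i ⪰ j`. -/
theorem dominates_of_polarG_ne_zero {n : ℕ} {i j : Fin (2 ^ n)} (h : polarG n i j ≠ 0) :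
    Dominates (i : ℕ) (j : ℕ) := by
  induction n with
  | zero =>
    have hij : i = j := Fin.ext (by omega)
    exact hij ▸ fun _ ht => ht
  | succ n ih =>
    obtain ⟨⟨a, b⟩, rfl⟩ := (finProdFinEquiv.trans (finCongr
      (show 2 * 2 ^ n = 2 ^ (n + 1) by rw [pow_succ, Nat.mul_comm]))).surjective i
    obtain ⟨⟨c, d⟩, rfl⟩ := (finProdFinEquiv.trans (finCongr
      (show 2 * 2 ^ n = 2 ^ (n + 1) by rw [pow_succ, Nat.mul_comm]))).surjective j
    have hmul : polarF a c * polarG n b d ≠ 0 := by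
      simpa only [polarG, Matrix.reindex_apply, Matrix.submatrix_apply, Equiv.symm_apply_apply,
        Matrix.kronecker, Matrix.kroneckerMap_apply] using h
    have hdom := Dominates.two_pow_mul_add b.isLt d.isLt
      (dominates_of_polarF_ne_zero (left_ne_zero_of_mul hmul)) (ih (right_ne_zero_of_mul hmul))
    simpa [add_comm] using hdom

theorem Nat.mod_four_eq_three_iff_testBit (i : ℕ) :
    i % 4 = 3 ↔ i.testBit 0 = true ∧ i.testBit 1 = true := by
  simp only [Nat.testBit_eq_decide_div_mod_eq, decide_eq_true_eq]
  omega

theorem Dominates.mod_four_eq_three {i j : ℕ} (h : Dominates i j) (hj : j % 4 = 3) :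
    i % 4 = 3 := by
  rw [Nat.mod_four_eq_three_iff_testBit] at hj ⊢
  exact ⟨h 0 hj.1, h 1 hj.2⟩

/-- Proposition 6, EPS: with `A` domination-upward-closed,
`D = {i : i ≡ 3 (mod 4)}`, `D_f = Ā ∩ D` and `C = A ∪ D_f`, the submatrix `G_C̄C` is zero. -/
theorem EPS_compl_zero (n : ℕ) (hn : 2 ≤ n)
    (A : Finset (Fin (2 ^ n))) (hA : UpClosed A) :
    ∀ i' : Fin (2 ^ n),
      i' ∉ A ∪ (Aᶜ ∩ Finset.univ.filter (fun i : Fin (2 ^ n) => (i : ℕ) % 4 = 3)) →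
      ∀ i ∈ A ∪ (Aᶜ ∩ Finset.univ.filter (fun i : Fin (2 ^ n) => (i : ℕ) % 4 = 3)),
        polarG n i' i = 0 := by
  intro i' hi' i hi
  by_contra h
  have hdom := dominates_of_polarG_ne_zero h
  simp only [Finset.mem_union, Finset.mem_inter, Finset.mem_compl, Finset.mem_filter,
    Finset.mem_univ, true_and] at hi hi'
  rcases hi with hi | ⟨-, hi⟩
  · exact hi' (Or.inl (hA i hi i' hdom))
  · exact hi' (or_iff_not_imp_left.mpr fun hA' => ⟨hA', hdom.mod_four_eq_three hi⟩)
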